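/- Let x ≤ a and let φ_0 : [a,∞) → [0,∞) be Borel with ∫_a^∞ φ_0(u)du < ∞. Let S_u = sup_{0≤v≤u} X_v be the running maximum of a standard Brownian motion started at 0. Then: (i) lim_{u→∞} √u · E_0[ φ_0( a ∨ (x + S_u) ) ] = √(2/π) · ( (a − x)·φ_0(a) + ∫_a^∞ φ_0(y)dy ); (ii) for every u > 0, E_0[ φ_0( a ∨ (x + S_u) ) ] ≤ √(2/(πu)) · ( (a − x)·φ_0(a) + ∫_a^∞ φ_0(y)dy ); (iii) for every u ≥ 1, E_0[ φ_0( a ∨ (x + S_u) ) ] ≥ √(2/(πu)) · ∫_a^∞ φ_0(y)·e^{−(y−x)²/2} dy. -/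

import Mathlib

open MeasureTheory ProbabilityTheory Filter
open scoped NNReal ENNReal Topology

noncomputable section

/-- The natural filtration `F_t = σ(X_s : s ≤ t)` of a real-valued process indexed by `ℝ≥0`. -/
def natFiltration {Ω : Type*} [m : MeasurableSpace Ω] (X : ℝ≥0 → Ω → ℝ) :
    MeasureTheory.Filtration ℝ≥0 m where
  seq t := (⨆ s ∈ Set.Iic t, MeasurableSpace.comap (X s) Real.measurableSpace) ⊓ m
  mono' := fun s t hst =>
    inf_le_inf_right m (biSup_mono fun u (hu : u ∈ Set.Iic s) => le_trans hu hst)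
  le' := fun _ => inf_le_right

/-- The running supremum `S_t = sup_{0 ≤ u ≤ t} X_u` of a process indexed by `ℝ≥0`. -/
def runSup {Ω : Type*} (X : ℝ≥0 → Ω → ℝ) (t : ℝ≥0) (ω : Ω) : ℝ :=
  sSup ((fun u => X u ω) '' Set.Iic t)

/-- A real-valued process `X` indexed by `ℝ≥0` is a standard one-dimensional Brownian
motion started at `x` under `P`. -/
structure IsBrownianMotion {Ω : Type*} [m : MeasurableSpace Ω] (P : Measure Ω)
    (X : ℝ≥0 → Ω → ℝ) (x : ℝ) : Prop where
  stronglyMeasurable : ∀ t, StronglyMeasurable (X t)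
  init : ∀ᵐ ω ∂P, X 0 ω = x
  cont : ∀ᵐ ω ∂P, Continuous fun t => X t ω
  gauss_incr : ∀ s t : ℝ≥0, s ≤ t →
    P.map (fun ω => X t ω - X s ω) = gaussianReal 0 (t - s)
  indep_incr : ∀ s t : ℝ≥0, s ≤ t →
    Indep (MeasurableSpace.comap (fun ω => X t ω - X s ω) Real.measurableSpace)
      (natFiltration X s) P

/-- A Fatou-type bound: if almost every point of `A` eventually lies in `B n`, then every uniform
bound on the measures of the `B n` bounds the measure of `A`. -/
lemma measure_le_of_ae_eventually_mem {Ω : Type*} [MeasurableSpace Ω] {P : Measure Ω} {A : Set Ω}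
    {B : ℕ → Set Ω} {c : ℝ≥0∞} (h : ∀ᵐ ω ∂P, ω ∈ A → ∀ᶠ n in atTop, ω ∈ B n)
    (hB : ∀ n, P (B n) ≤ c) : P A ≤ c := by
  have hmono : Monotone fun n => ⋂ m ≥ n, B m := fun i j hij =>
    Set.biInter_subset_biInter_left fun m hm => le_trans hij hm
  calc P A ≤ P (⋃ n, ⋂ m ≥ n, B m) := measure_mono_ae (h.mono fun ω hω hA => by
        obtain ⟨n, hn⟩ := eventually_atTop.1 (hω hA)
        exact Set.mem_iUnion.2 ⟨n, Set.mem_iInter₂.2 hn⟩)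
    _ = ⨆ n, P (⋂ m ≥ n, B m) := hmono.measure_iUnion
    _ ≤ c := iSup_le fun n => (measure_mono (Set.biInter_subset_of_mem (le_refl n))).trans (hB n)

lemma gaussianReal_zero_Iio_zero (v : ℝ≥0) :
    gaussianReal 0 v (Set.Iio 0) = gaussianReal 0 v (Set.Ioi 0) := by
  conv_lhs => rw [← neg_zero (G := ℝ), ← gaussianReal_map_neg]
  rw [Measure.map_apply measurable_neg measurableSet_Iio]
  simp

lemma two_mul_gaussianReal_Ioi_zero_le (v : ℝ≥0) : 2 * gaussianReal 0 v (Set.Ioi 0) ≤ 1 := by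
  rw [two_mul]
  nth_rewrite 1 [← gaussianReal_zero_Iio_zero]
  rw [← measure_union (s₁ := Set.Iio (0 : ℝ)) (s₂ := Set.Ioi 0)
    (Set.disjoint_left.2 fun y (hy : y < 0) (hy' : 0 < y) => lt_asymm hy hy') measurableSet_Ioi]
  exact prob_le_one

lemma one_le_two_mul_gaussianReal_Ici_zero (v : ℝ≥0) : 1 ≤ 2 * gaussianReal 0 v (Set.Ici 0) := by
  rw [← measure_univ (μ := gaussianReal 0 v), ← Set.Iio_union_Ici (a := (0 : ℝ)), two_mul]
  refine (measure_union_le _ _).trans ?_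
  rw [gaussianReal_zero_Iio_zero]
  gcongr
  exact Set.Ioi_subset_Ici_self

/-- The event that the process sampled at the times `T 0, T 1, …` exceeds `b` for the first time at
index `k`. -/
def firstPassage {Ω : Type*} (X : ℝ≥0 → Ω → ℝ) (T : ℕ → ℝ≥0) (b : ℝ) (k : ℕ) : Set Ω :=
  {ω | b < X (T k) ω ∧ ∀ j < k, X (T j) ω ≤ b}

lemma pairwise_disjoint_firstPassage {Ω : Type*} (X : ℝ≥0 → Ω → ℝ) (T : ℕ → ℝ≥0) (b : ℝ) :
    Pairwise (Function.onFun Disjoint (firstPassage X T b)) := by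
  intro i j hij
  refine Set.disjoint_left.2 fun ω hi hj => ?_
  rcases lt_or_gt_of_ne hij with h | h
  · exact (hj.2 i h).not_gt hi.1
  · exact (hi.2 j h).not_gt hj.1

lemma exists_mem_firstPassage {Ω : Type*} {X : ℝ≥0 → Ω → ℝ} {T : ℕ → ℝ≥0} {b : ℝ} {ω : Ω} {k : ℕ}
    (h : b < X (T k) ω) : ∃ i ≤ k, ω ∈ firstPassage X T b i := by
  classical
  have hex : ∃ i, b < X (T i) ω := ⟨k, h⟩
  exact ⟨Nat.find hex, Nat.find_min' hex h, Nat.find_spec hex,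
    fun j hj => not_lt.1 (Nat.find_min hex hj)⟩

namespace IsBrownianMotion

variable {Ω : Type*} [m : MeasurableSpace Ω] {P : Measure Ω} {X : ℝ≥0 → Ω → ℝ}

lemma measurable_natFiltration {x : ℝ} (hX : IsBrownianMotion P X x) {s t : ℝ≥0} (hst : s ≤ t) :
    Measurable[natFiltration X t] (X s) := by
  have h : MeasurableSpace.comap (X s) Real.measurableSpace ≤ natFiltration X t :=
    le_inf (le_biSup (fun s => MeasurableSpace.comap (X s) Real.measurableSpace)
      (Set.mem_Iic.2 hst)) (hX.stronglyMeasurable s).measurable.comap_le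
  exact (comap_measurable (X s)).mono h le_rfl

lemma measurableSet_firstPassage {x : ℝ} (hX : IsBrownianMotion P X x) {T : ℕ → ℝ≥0}
    (hT : Monotone T) (b : ℝ) (k : ℕ) :
    MeasurableSet[natFiltration X (T k)] (firstPassage X T b k) := by
  have : firstPassage X T b k =
      X (T k) ⁻¹' Set.Ioi b ∩ ⋂ j, ⋂ (_ : j < k), X (T j) ⁻¹' Set.Iic b := by
    ext ω
    simp [firstPassage]
  rw [this]
  exact (hX.measurable_natFiltration le_rfl measurableSet_Ioi).inter
    (MeasurableSet.iInter fun j => MeasurableSet.iInter fun hj =>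
      hX.measurable_natFiltration (hT hj.le) measurableSet_Iic)

lemma measurable_incr {x : ℝ} (hX : IsBrownianMotion P X x) (s t : ℝ≥0) :
    Measurable fun ω => X t ω - X s ω :=
  (hX.stronglyMeasurable t).measurable.sub (hX.stronglyMeasurable s).measurable

lemma measure_inter_incr {x : ℝ} (hX : IsBrownianMotion P X x) {s t : ℝ≥0} (hst : s ≤ t)
    {A : Set Ω} (hA : MeasurableSet[natFiltration X s] A) {B : Set ℝ} (hB : MeasurableSet B) :
    P (A ∩ (fun ω => X t ω - X s ω) ⁻¹' B) = P A * gaussianReal 0 (t - s) B := by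
  rw [Set.inter_comm, (Indep_iff _ _ _).1 (hX.indep_incr s t hst) _ _ ⟨B, hB, rfl⟩ hA, mul_comm,
    ← hX.gauss_incr s t hst, Measure.map_apply (hX.measurable_incr s t) hB]

lemma measure_biUnion_firstPassage_inter {x : ℝ} (hX : IsBrownianMotion P X x) {T : ℕ → ℝ≥0}
    (hT : Monotone T) {t : ℝ≥0} (hTt : ∀ k, T k ≤ t) (b : ℝ) (N : ℕ) {B : Set ℝ}
    (hB : MeasurableSet B) :
    P (⋃ k ∈ Finset.range N, firstPassage X T b k ∩ (fun ω => X t ω - X (T k) ω) ⁻¹' B) =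
      ∑ k ∈ Finset.range N, P (firstPassage X T b k) * gaussianReal 0 (t - T k) B := by
  rw [measure_biUnion_finset]
  · exact Finset.sum_congr rfl fun k _ =>
      hX.measure_inter_incr (hTt k) (hX.measurableSet_firstPassage hT b k) hB
  · exact fun i _ j _ hij => (pairwise_disjoint_firstPassage X T b hij).mono
      Set.inter_subset_left Set.inter_subset_left
  · exact fun k _ => ((natFiltration X).le _ _ (hX.measurableSet_firstPassage hT b k)).inter
      (hX.measurable_incr _ _ hB)

lemma measure_biUnion_firstPassage {x : ℝ} (hX : IsBrownianMotion P X x) {T : ℕ → ℝ≥0}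
    (hT : Monotone T) (b : ℝ) (N : ℕ) :
    P (⋃ k ∈ Finset.range N, firstPassage X T b k) =
      ∑ k ∈ Finset.range N, P (firstPassage X T b k) :=
  measure_biUnion_finset (fun _ _ _ _ hij => pairwise_disjoint_firstPassage X T b hij)
    fun k _ => (natFiltration X).le _ _ (hX.measurableSet_firstPassage hT b k)

lemma measure_biUnion_firstPassage_le {x : ℝ} (hX : IsBrownianMotion P X x) {T : ℕ → ℝ≥0}
    (hT : Monotone T) {t : ℝ≥0} (hTt : ∀ k, T k ≤ t) (b : ℝ) (N : ℕ) :
    P (⋃ k ∈ Finset.range N, firstPassage X T b k) ≤ 2 * P {ω | b < X t ω} := by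
  calc P (⋃ k ∈ Finset.range N, firstPassage X T b k)
      ≤ 2 * ∑ k ∈ Finset.range N,
          P (firstPassage X T b k) * gaussianReal 0 (t - T k) (Set.Ici 0) := by
        rw [hX.measure_biUnion_firstPassage hT, Finset.mul_sum]
        refine Finset.sum_le_sum fun k _ => ?_
        rw [mul_left_comm]
        exact le_mul_of_one_le_right' (one_le_two_mul_gaussianReal_Ici_zero _)
    _ = 2 * P (⋃ k ∈ Finset.range N,
          firstPassage X T b k ∩ (fun ω => X t ω - X (T k) ω) ⁻¹' Set.Ici 0) := by
        rw [hX.measure_biUnion_firstPassage_inter hT hTt b N measurableSet_Ici]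
    _ ≤ 2 * P {ω | b < X t ω} := by
        gcongr
        refine Set.iUnion₂_subset fun k _ ω hω => ?_
        exact hω.1.1.trans_le (sub_nonneg.1 hω.2)

lemma two_mul_measure_biUnion_firstPassage_inter_le {x : ℝ} (hX : IsBrownianMotion P X x)
    {T : ℕ → ℝ≥0} (hT : Monotone T) {t : ℝ≥0} (hTt : ∀ k, T k ≤ t) (b : ℝ) (N : ℕ) :
    2 * P (⋃ k ∈ Finset.range N,
      firstPassage X T b k ∩ (fun ω => X t ω - X (T k) ω) ⁻¹' Set.Ioi 0) ≤
        P (⋃ k ∈ Finset.range N, firstPassage X T b k) := by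
  rw [hX.measure_biUnion_firstPassage_inter hT hTt b N measurableSet_Ioi,
    hX.measure_biUnion_firstPassage hT, Finset.mul_sum]
  refine Finset.sum_le_sum fun k _ => ?_
  rw [mul_left_comm]
  exact mul_le_of_le_one_right' (two_mul_gaussianReal_Ioi_zero_le _)

end IsBrownianMotion

lemma bddAbove_image_Iic {f : ℝ≥0 → ℝ} (hf : Continuous f) (t : ℝ≥0) :
    BddAbove (f '' Set.Iic t) := by
  rw [← Set.Icc_bot]
  exact (isCompact_Icc.image hf).bddAbove

lemma lt_runSup_iff {Ω : Type*} {X : ℝ≥0 → Ω → ℝ} {ω : Ω} (hc : Continuous fun t => X t ω)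
    (t : ℝ≥0) (b : ℝ) : b < runSup X t ω ↔ ∃ s ≤ t, b < X s ω := by
  rw [runSup, lt_csSup_iff (bddAbove_image_Iic hc t) (Set.nonempty_Iic.image _)]
  simp

/-- The regular grid on `[0, t]` with mesh `1 / (n + 1)`, constant equal to `t` from some index. -/
def timeGrid (t : ℝ≥0) (n k : ℕ) : ℝ≥0 := min t (k / (n + 1))

lemma monotone_timeGrid (t : ℝ≥0) (n : ℕ) : Monotone (timeGrid t n) := fun i j hij => by
  unfold timeGrid
  gcongr

lemma timeGrid_le (t : ℝ≥0) (n k : ℕ) : timeGrid t n k ≤ t := min_le_left _ _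

lemma timeGrid_zero (t : ℝ≥0) (n : ℕ) : timeGrid t n 0 = 0 := by simp [timeGrid]

lemma timeGrid_ceil (t : ℝ≥0) (n : ℕ) : timeGrid t n ⌈t * (n + 1)⌉₊ = t := by
  refine min_eq_left ?_
  rw [le_div_iff₀ (by positivity)]
  exact Nat.le_ceil _

lemma dist_timeGrid_succ_le (t : ℝ≥0) (n k : ℕ) :
    dist (timeGrid t n (k + 1)) (timeGrid t n k) ≤ 1 / ((n : ℝ) + 1) := by
  rw [NNReal.dist_eq]
  simp only [timeGrid, NNReal.coe_min]
  refine (abs_min_sub_min_le_max _ _ _ _).trans (max_le (by simp; positivity) ?_)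
  push_cast
  rw [← sub_div, add_sub_cancel_left, abs_of_nonneg (by positivity)]

lemma exists_dist_timeGrid_le {s t : ℝ≥0} (hst : s ≤ t) (n : ℕ) :
    ∃ k ≤ ⌈t * (n + 1)⌉₊, dist (timeGrid t n k) s ≤ 1 / ((n : ℝ) + 1) := by
  have hpos : (0 : ℝ≥0) < n + 1 := by positivity
  have hle : (⌊s * (n + 1)⌋₊ : ℝ≥0) / (n + 1) ≤ s := by
    rw [div_le_iff₀ hpos]
    exact Nat.floor_le zero_le
  refine ⟨⌊s * (n + 1)⌋₊, (Nat.floor_le_ceil _).trans (Nat.ceil_mono (by gcongr)), ?_⟩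
  rw [timeGrid, min_eq_right (hle.trans hst), dist_comm, NNReal.dist_eq,
    abs_of_nonneg (sub_nonneg.2 (NNReal.coe_le_coe.2 hle))]
  push_cast
  have h : (s : ℝ) * (n + 1) < ⌊s * (n + 1)⌋₊ + 1 := by
    exact_mod_cast Nat.lt_floor_add_one (s * ((n : ℝ≥0) + 1))
  rw [sub_le_iff_le_add, ← add_div, le_div_iff₀ (by positivity)]
  linarith

lemma eventually_exists_mem_firstPassage {Ω : Type*} {X : ℝ≥0 → Ω → ℝ} {ω : Ω}
    (hc : Continuous fun t => X t ω) {s t : ℝ≥0} (hst : s ≤ t) {b : ℝ} (hb : b < X s ω) :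
    ∀ᶠ n : ℕ in atTop, ∃ k ≤ ⌈t * (n + 1)⌉₊, ω ∈ firstPassage X (timeGrid t n) b k := by
  obtain ⟨δ, hδ, hball⟩ := Metric.mem_nhds_iff.1 ((isOpen_Ioi.preimage hc).mem_nhds hb)
  filter_upwards [tendsto_one_div_add_atTop_nhds_zero_nat.eventually_lt_const hδ] with n hn
  obtain ⟨k, hk, hd⟩ := exists_dist_timeGrid_le hst n
  obtain ⟨i, hi, hmem⟩ := exists_mem_firstPassage (X := X) (T := timeGrid t n)
    (hball (Metric.mem_ball.2 (hd.trans_lt hn)))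
  exact ⟨i, hi.trans hk, hmem⟩

lemma eventually_exists_mem_firstPassage_inter {Ω : Type*} {X : ℝ≥0 → Ω → ℝ} {ω : Ω}
    (hc : Continuous fun t => X t ω) {t : ℝ≥0} {b : ℝ} (h0 : X 0 ω ≤ b) (hb : b < X t ω) :
    ∀ᶠ n : ℕ in atTop, ∃ k ≤ ⌈t * (n + 1)⌉₊, ω ∈ firstPassage X (timeGrid t n) b k ∧
      X (timeGrid t n k) ω < X t ω := by
  obtain ⟨δ, hδ, huc⟩ := Metric.uniformContinuousOn_iff.1
    ((isCompact_Icc (a := 0) (b := t)).uniformContinuousOn_of_continuous hc.continuousOn)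
    (X t ω - b) (sub_pos.2 hb)
  filter_upwards [tendsto_one_div_add_atTop_nhds_zero_nat.eventually_lt_const hδ] with n hn
  obtain ⟨k, hk, hmem⟩ := exists_mem_firstPassage (X := X) (T := timeGrid t n) (b := b) (ω := ω)
    (k := ⌈t * (n + 1)⌉₊) (by rwa [timeGrid_ceil])
  refine ⟨k, hk, hmem, ?_⟩
  cases k with
  | zero =>
    have := hmem.1
    rw [timeGrid_zero] at this
    exact absurd h0 this.not_ge
  | succ k =>
    have h1 := huc (timeGrid t n (k + 1)) ⟨zero_le, timeGrid_le _ _ _⟩ (timeGrid t n k)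
      ⟨zero_le, timeGrid_le _ _ _⟩ ((dist_timeGrid_succ_le t n k).trans_lt hn)
    have h2 := hmem.2 k (Nat.lt_succ_self k)
    have h3 := (abs_lt.1 (Real.dist_eq _ _ ▸ h1)).2
    linarith

namespace IsBrownianMotion

variable {Ω : Type*} [m : MeasurableSpace Ω] {P : Measure Ω} {X : ℝ≥0 → Ω → ℝ}

/-- The reflection principle for Brownian motion. -/
lemma measure_lt_runSup {x : ℝ} (hX : IsBrownianMotion P X x) (t : ℝ≥0) {b : ℝ} (hb : x ≤ b) :
    P {ω | b < runSup X t ω} = 2 * P {ω | b < X t ω} := by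
  refine le_antisymm ?_ ?_
  · refine measure_le_of_ae_eventually_mem (B := fun n => ⋃ k ∈ Finset.range (⌈t * (n + 1)⌉₊ + 1),
      firstPassage X (timeGrid t n) b k) ?_ fun n =>
        hX.measure_biUnion_firstPassage_le (monotone_timeGrid t n) (timeGrid_le t n) b _
    filter_upwards [hX.cont] with ω hc hω
    obtain ⟨s, hst, hs⟩ := (lt_runSup_iff hc t b).1 hω
    filter_upwards [eventually_exists_mem_firstPassage hc hst hs] with n ⟨k, hk, hmem⟩
    exact Set.mem_iUnion₂.2 ⟨k, Finset.mem_range.2 (Nat.lt_succ_of_le hk), hmem⟩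
  · rw [mul_comm, ← ENNReal.le_div_iff_mul_le (by simp) (by simp)]
    refine measure_le_of_ae_eventually_mem (B := fun n => ⋃ k ∈ Finset.range (⌈t * (n + 1)⌉₊ + 1),
      firstPassage X (timeGrid t n) b k ∩
        (fun ω => X t ω - X (timeGrid t n k) ω) ⁻¹' Set.Ioi 0) ?_ fun n => ?_
    · filter_upwards [hX.cont, hX.init] with ω hc h0 hω
      filter_upwards [eventually_exists_mem_firstPassage_inter hc (h0.trans_le hb) hω]
        with n ⟨k, hk, hmem, hlt⟩
      exact Set.mem_iUnion₂.2 ⟨k, Finset.mem_range.2 (Nat.lt_succ_of_le hk), hmem, sub_pos.2 hlt⟩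
    · rw [ENNReal.le_div_iff_mul_le (by simp) (by simp), mul_comm]
      refine (hX.two_mul_measure_biUnion_firstPassage_inter_le (monotone_timeGrid t n)
        (timeGrid_le t n) b _).trans (measure_mono_ae ?_)
      filter_upwards [hX.cont] with ω hc hω
      obtain ⟨k, _, hmem⟩ := Set.mem_iUnion₂.1 hω
      exact (lt_runSup_iff hc t b).2 ⟨_, timeGrid_le t n k, hmem.1⟩

lemma map_eq_gaussianReal (hX : IsBrownianMotion P X 0) (t : ℝ≥0) :
    P.map (X t) = gaussianReal 0 t := by
  have h := hX.gauss_incr 0 t zero_le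
  rw [tsub_zero] at h
  rw [← h]
  refine Measure.map_congr ?_
  filter_upwards [hX.init] with ω hω
  simp [hω]

lemma aemeasurable_runSup {x : ℝ} (hX : IsBrownianMotion P X x) (t : ℝ≥0) :
    AEMeasurable (runSup X t) P := by
  refine ⟨fun ω => ⨆ n : ℕ, X (TopologicalSpace.denseSeq (Set.Iic t) n) ω,
    Measurable.iSup fun n => (hX.stronglyMeasurable _).measurable, ?_⟩
  filter_upwards [hX.cont] with ω hc
  have hbdd := bddAbove_image_Iic hc t
  have hsub : Set.range (fun n => X (TopologicalSpace.denseSeq (Set.Iic t) n) ω) ⊆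
      (fun u => X u ω) '' Set.Iic t := by
    rintro _ ⟨n, rfl⟩
    exact ⟨_, (TopologicalSpace.denseSeq (Set.Iic t) n).2, rfl⟩
  refine le_antisymm (csSup_le (Set.nonempty_Iic.image _) ?_)
    (csSup_le_csSup hbdd (Set.range_nonempty _) hsub)
  rintro _ ⟨s, hs, rfl⟩
  have hclosed : IsClosed {s : Set.Iic t |
      X s ω ≤ ⨆ n : ℕ, X (TopologicalSpace.denseSeq (Set.Iic t) n) ω} :=
    isClosed_le (hc.comp continuous_subtype_val) continuous_const
  exact (TopologicalSpace.denseRange_denseSeq (Set.Iic t)).induction_on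
    (p := fun s : Set.Iic t => X s ω ≤ ⨆ n : ℕ, X (TopologicalSpace.denseSeq (Set.Iic t) n) ω)
    ⟨s, hs⟩ hclosed fun n => le_ciSup (hbdd.mono hsub) n

/-- The running maximum at time `t` of a Brownian motion started at `0` is distributed as the
absolute value of a centred Gaussian variable with variance `t`. -/
lemma map_runSup_eq [IsProbabilityMeasure P] (hX : IsBrownianMotion P X 0) {t : ℝ≥0}
    (ht : t ≠ 0) :
    P.map (runSup X t) = (2 : ℝ≥0∞) • (gaussianReal 0 t).restrict (Set.Ioi 0) := by
  have hS := hX.aemeasurable_runSup t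
  have : IsProbabilityMeasure (P.map (runSup X t)) := Measure.isProbabilityMeasure_map hS
  have := nullSingletonClass_gaussianReal (μ := 0) ht
  have hhalf : 2 * gaussianReal 0 t (Set.Ioi 0) = 1 :=
    le_antisymm (two_mul_gaussianReal_Ioi_zero_le t)
      (measure_congr (μ := gaussianReal 0 t) Ioi_ae_eq_Ici ▸
        one_le_two_mul_gaussianReal_Ici_zero t)
  have hIoi : ∀ b, 0 ≤ b → P.map (runSup X t) (Set.Ioi b) = 2 * gaussianReal 0 t (Set.Ioi b) := by
    intro b hb
    rw [Measure.map_apply_of_aemeasurable hS measurableSet_Ioi, ← hX.map_eq_gaussianReal t,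
      Measure.map_apply (hX.stronglyMeasurable t).measurable measurableSet_Ioi]
    exact hX.measure_lt_runSup t hb
  refine ext_of_generate_finite _ (borel_eq_generateFrom_Ioi ℝ ▸ Real.borelSpace.measurable_eq)
    isPiSystem_Ioi ?_ (by simp [hhalf])
  rintro _ ⟨b, rfl⟩
  rw [Measure.smul_apply, smul_eq_mul, Measure.restrict_apply measurableSet_Ioi, Set.Ioi_inter_Ioi]
  rcases le_total 0 b with hb | hb
  · rw [hIoi b hb, sup_eq_left.2 hb]
  · rw [sup_eq_right.2 hb, hhalf]
    exact le_antisymm prob_le_one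
      (hhalf ▸ hIoi 0 le_rfl ▸ measure_mono (Set.Ioi_subset_Ioi hb))

lemma integral_comp_runSup [IsProbabilityMeasure P] (hX : IsBrownianMotion P X 0) {t : ℝ≥0}
    (ht : t ≠ 0) {f : ℝ → ℝ} (hf : Measurable f) :
    ∫ ω, f (runSup X t ω) ∂P =
      √(2 / (Real.pi * t)) * ∫ s in Set.Ioi 0, f s * Real.exp (-s ^ 2 / (2 * t)) := by
  have ht' : (0 : ℝ) < t := by positivity
  have hconst : 2 * (√(2 * Real.pi * t))⁻¹ = √(2 / (Real.pi * t)) := by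
    rw [show 2 / (Real.pi * t) = 2 ^ 2 * (2 * Real.pi * t)⁻¹ by field_simp,
      Real.sqrt_mul (by positivity) (2 * Real.pi * t)⁻¹, Real.sqrt_sq (by norm_num), Real.sqrt_inv]
  rw [← integral_map (hX.aemeasurable_runSup t) hf.aestronglyMeasurable, hX.map_runSup_eq ht,
    integral_smul_measure, ← integral_indicator measurableSet_Ioi,
    integral_gaussianReal_eq_integral_smul ht, ← integral_indicator measurableSet_Ioi,
    ENNReal.toReal_ofNat, smul_eq_mul, ← integral_const_mul, ← integral_const_mul]
  refine integral_congr_ae (ae_of_all _ fun s => ?_)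
  by_cases hs : s ∈ Set.Ioi 0
  · simp only [Set.indicator_of_mem hs, smul_eq_mul, gaussianPDFReal, sub_zero, ← hconst]
    ring
  · simp [Set.indicator_of_notMem hs]

end IsBrownianMotion

section TruncatedShift

variable {x a : ℝ} {φ : ℝ → ℝ}

lemma integrableOn_comp_const_add_Ioi (x : ℝ) (h : IntegrableOn φ (Set.Ici a)) :
    IntegrableOn (fun s => φ (x + s)) (Set.Ioi (a - x)) := by
  have h' := ((measurePreserving_add_left volume x).integrableOn_comp_preimage
    (measurableEmbedding_addLeft x)).2 (h.mono_set Set.Ioi_subset_Ici_self)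
  rwa [Set.preimage_const_add_Ioi] at h'

lemma setIntegral_comp_const_add_Ioi (x a : ℝ) (φ : ℝ → ℝ) :
    ∫ s in Set.Ioi (a - x), φ (x + s) = ∫ y in Set.Ici a, φ y := by
  rw [integral_Ici_eq_integral_Ioi, ← Set.preimage_const_add_Ioi]
  exact (measurePreserving_add_left volume x).setIntegral_preimage_emb
    (measurableEmbedding_addLeft x) φ (Set.Ioi a)

lemma comp_max_eqOn_Ioc (x a : ℝ) (φ : ℝ → ℝ) :
    Set.EqOn (fun s => φ (max a (x + s))) (fun _ => φ a) (Set.Ioc 0 (a - x)) := fun s hs => by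
  simp only [max_eq_left (show x + s ≤ a by linarith [hs.2])]

lemma comp_max_eqOn_Ioi (x a : ℝ) (φ : ℝ → ℝ) :
    Set.EqOn (fun s => φ (max a (x + s))) (fun s => φ (x + s)) (Set.Ioi (a - x)) := fun s hs => by
  simp only [max_eq_right (show a ≤ x + s by linarith [Set.mem_Ioi.1 hs])]

lemma integrableOn_comp_max_Ioc (x a : ℝ) (φ : ℝ → ℝ) :
    IntegrableOn (fun s => φ (max a (x + s))) (Set.Ioc 0 (a - x)) :=
  (integrableOn_congr_fun (comp_max_eqOn_Ioc x a φ) measurableSet_Ioc).2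
    (integrableOn_const (by simp))

lemma integrableOn_comp_max_Ioi (x : ℝ) (h : IntegrableOn φ (Set.Ici a)) :
    IntegrableOn (fun s => φ (max a (x + s))) (Set.Ioi (a - x)) :=
  (integrableOn_congr_fun (comp_max_eqOn_Ioi x a φ) measurableSet_Ioi).2
    (integrableOn_comp_const_add_Ioi x h)

lemma integrableOn_comp_max (hxa : x ≤ a) (h : IntegrableOn φ (Set.Ici a)) :
    IntegrableOn (fun s => φ (max a (x + s))) (Set.Ioi 0) := by
  rw [← Set.Ioc_union_Ioi_eq_Ioi (sub_nonneg.2 hxa)]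
  exact (integrableOn_comp_max_Ioc x a φ).union (integrableOn_comp_max_Ioi x h)

lemma setIntegral_comp_max (hxa : x ≤ a) (h : IntegrableOn φ (Set.Ici a)) :
    ∫ s in Set.Ioi 0, φ (max a (x + s)) = (a - x) * φ a + ∫ y in Set.Ici a, φ y := by
  rw [← Set.Ioc_union_Ioi_eq_Ioi (sub_nonneg.2 hxa),
    setIntegral_union (Set.Ioc_disjoint_Ioi le_rfl) measurableSet_Ioi
      (integrableOn_comp_max_Ioc x a φ) (integrableOn_comp_max_Ioi x h),
    setIntegral_congr_fun measurableSet_Ioc (comp_max_eqOn_Ioc x a φ),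
    setIntegral_congr_fun measurableSet_Ioi (comp_max_eqOn_Ioi x a φ),
    setIntegral_comp_const_add_Ioi]
  simp [hxa]

end TruncatedShift

section GaussianWeight

variable {f : ℝ → ℝ}

lemma exp_neg_sq_div_le_one (u : ℝ≥0) (s : ℝ) : Real.exp (-s ^ 2 / (2 * u)) ≤ 1 :=
  Real.exp_le_one_iff.2 (div_nonpos_of_nonpos_of_nonneg (by nlinarith [sq_nonneg s])
    (by positivity))

lemma norm_mul_exp_neg_sq_div_le (f : ℝ → ℝ) (u : ℝ≥0) (s : ℝ) :
    ‖f s * Real.exp (-s ^ 2 / (2 * u))‖ ≤ ‖f s‖ := by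
  rw [norm_mul, Real.norm_of_nonneg (Real.exp_pos _).le]
  exact mul_le_of_le_one_right (norm_nonneg _) (exp_neg_sq_div_le_one u s)

lemma integrableOn_mul_exp_neg_sq_div {S : Set ℝ} (hf : IntegrableOn f S) (u : ℝ≥0) :
    IntegrableOn (fun s => f s * Real.exp (-s ^ 2 / (2 * u))) S :=
  Integrable.mono hf (hf.aestronglyMeasurable.mul (by fun_prop))
    (ae_of_all _ (norm_mul_exp_neg_sq_div_le f u))

lemma tendsto_setIntegral_mul_exp_neg_sq_div {S : Set ℝ} (hf : IntegrableOn f S) :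
    Tendsto (fun u : ℝ≥0 => ∫ s in S, f s * Real.exp (-s ^ 2 / (2 * u))) atTop
      (𝓝 (∫ s in S, f s)) := by
  refine tendsto_integral_filter_of_dominated_convergence (fun s => ‖f s‖)
    (Eventually.of_forall fun u => (integrableOn_mul_exp_neg_sq_div hf u).aestronglyMeasurable)
    (Eventually.of_forall fun u => ae_of_all _ (norm_mul_exp_neg_sq_div_le f u)) hf.norm
    (ae_of_all _ fun s => ?_)
  have h : Tendsto (fun u : ℝ≥0 => -s ^ 2 / (2 * (u : ℝ))) atTop (𝓝 0) :=
    Tendsto.const_div_atTop ((NNReal.tendsto_coe_atTop.2 tendsto_id).const_mul_atTop two_pos) _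
  simpa using ((Real.continuous_exp.tendsto 0).comp h).const_mul (f s)

end GaussianWeight

/-- Asymptotics of `E_0[φ₀(a ∨ (x + S_u))]` as `u → ∞`, with matching upper and
lower bounds, for a Brownian motion started at `0` with running maximum `S`. -/
theorem sup_expectation_asymptotics
    {Ω : Type*} [m : MeasurableSpace Ω] (P : Measure Ω) [IsProbabilityMeasure P]
    (X : ℝ≥0 → Ω → ℝ) (hX : IsBrownianMotion P X 0)
    (x a : ℝ) (hxa : x ≤ a)
    (φ₀ : ℝ → ℝ) (hφ₀meas : Measurable φ₀) (hφ₀nonneg : ∀ y, a ≤ y → 0 ≤ φ₀ y)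
    (hφ₀int : IntegrableOn φ₀ (Set.Ici a)) :
    Tendsto
        (fun u : ℝ≥0 => Real.sqrt u * ∫ ω, φ₀ (max a (x + runSup X u ω)) ∂P)
        atTop
        (nhds (Real.sqrt (2 / Real.pi) *
          ((a - x) * φ₀ a + ∫ y in Set.Ici a, φ₀ y))) ∧
      (∀ u : ℝ≥0, 0 < u →
        ∫ ω, φ₀ (max a (x + runSup X u ω)) ∂P
          ≤ Real.sqrt (2 / (Real.pi * u)) *
              ((a - x) * φ₀ a + ∫ y in Set.Ici a, φ₀ y)) ∧
      (∀ u : ℝ≥0, 1 ≤ u →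
        Real.sqrt (2 / (Real.pi * u)) *
            ∫ y in Set.Ici a, φ₀ y * Real.exp (-(y - x) ^ 2 / 2)
          ≤ ∫ ω, φ₀ (max a (x + runSup X u ω)) ∂P) := by
  have hmeas : Measurable fun s => φ₀ (max a (x + s)) := by fun_prop
  have hint := integrableOn_comp_max hxa hφ₀int
  have hnonneg : ∀ s, 0 ≤ φ₀ (max a (x + s)) := fun s => hφ₀nonneg _ (le_max_left _ _)
  have hE : ∀ u : ℝ≥0, 0 < u → ∫ ω, φ₀ (max a (x + runSup X u ω)) ∂P = √(2 / (Real.pi * u)) *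
      ∫ s in Set.Ioi 0, φ₀ (max a (x + s)) * Real.exp (-s ^ 2 / (2 * u)) := fun u hu =>
    hX.integral_comp_runSup hu.ne' hmeas
  rw [← setIntegral_comp_max hxa hφ₀int]
  refine ⟨?_, fun u hu => ?_, fun u hu => ?_⟩
  · refine ((tendsto_setIntegral_mul_exp_neg_sq_div hint).const_mul _).congr' ?_
    filter_upwards [eventually_gt_atTop 0] with u hu
    rw [hE u hu, ← mul_assoc, ← Real.sqrt_mul u.coe_nonneg]
    have : (u : ℝ) ≠ 0 := by positivity
    congr 2
    field_simp
  · rw [hE u hu]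
    refine mul_le_mul_of_nonneg_left (setIntegral_mono (integrableOn_mul_exp_neg_sq_div hint u) hint
      fun s => ?_) (Real.sqrt_nonneg _)
    exact mul_le_of_le_one_right (hnonneg s) (exp_neg_sq_div_le_one u s)
  · have hu' : (1 : ℝ) ≤ u := hu
    rw [hE u (zero_lt_one.trans_le hu), ← setIntegral_comp_const_add_Ioi x]
    refine mul_le_mul_of_nonneg_left ?_ (Real.sqrt_nonneg _)
    refine le_trans ?_ (setIntegral_mono_set (integrableOn_mul_exp_neg_sq_div hint u)
      (ae_of_all _ fun s => mul_nonneg (hnonneg s) (Real.exp_pos _).le)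
      (Set.Ioi_subset_Ioi (sub_nonneg.2 hxa)).eventuallyLE)
    refine setIntegral_mono_on ?_
      (integrableOn_mul_exp_neg_sq_div (integrableOn_comp_max_Ioi x hφ₀int) u)
      measurableSet_Ioi fun s hs => ?_
    · simpa using integrableOn_mul_exp_neg_sq_div (integrableOn_comp_const_add_Ioi x hφ₀int) 1
    · have hs' : φ₀ (max a (x + s)) = φ₀ (x + s) := comp_max_eqOn_Ioi x a φ₀ hs
      rw [← hs', add_sub_cancel_left]
      refine mul_le_mul_of_nonneg_left (Real.exp_le_exp.2 ?_) (hnonneg s)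
      rw [neg_div, neg_div, neg_le_neg_iff]
      exact div_le_div_of_nonneg_left (sq_nonneg s) two_pos (by linarith)

end
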